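/- arXiv:2311.06404 — 3 statements merged into one kernel-verified Lean document; each statement's English description precedes it below -/
import Mathlib

section
/- (Riccati update: Joseph form equals standard form, and positive semidefiniteness is preserved) With M := R + B̄ᵀ P B̄ and K := M⁻¹ B̄ᵀ P Ā, the matrix P′ := Q + Kᵀ R K + (Ā − B̄ K)ᵀ P (Ā − B̄ K) satisfies P′ = Q + Āᵀ P Ā − Āᵀ P B̄ M⁻¹ B̄ᵀ P Ā, and P′ is symmetric positive semidefinite. -/
open Matrix

/-- (Riccati update: Joseph form equals standard form, and positive semidefiniteness is
preserved) With `M := R + B̄ᵀPB̄` and `K := M⁻¹B̄ᵀPĀ`, the matrix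
`P′ := Q + KᵀRK + (Ā − B̄K)ᵀP(Ā − B̄K)` satisfies
`P′ = Q + ĀᵀPĀ − ĀᵀPB̄M⁻¹B̄ᵀPĀ`, and `P′` is symmetric positive semidefinite. -/
theorem riccati_joseph_form
    (d m : ℕ) (hd : 0 < d) (hm : 0 < m)
    (Q : Matrix (Fin d) (Fin d) ℝ) (hQ : Q.PosSemidef)
    (R : Matrix (Fin m) (Fin m) ℝ) (hR : R.PosDef)
    (Abar : Matrix (Fin d) (Fin d) ℝ) (Bbar : Matrix (Fin d) (Fin m) ℝ)
    (P : Matrix (Fin d) (Fin d) ℝ) (hP : P.PosSemidef)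
    (M : Matrix (Fin m) (Fin m) ℝ) (hM : M = R + Bbarᵀ * P * Bbar)
    (K : Matrix (Fin m) (Fin d) ℝ) (hK : K = M⁻¹ * (Bbarᵀ * P * Abar))
    (P' : Matrix (Fin d) (Fin d) ℝ)
    (hP' : P' = Q + Kᵀ * R * K + (Abar - Bbar * K)ᵀ * P * (Abar - Bbar * K)) :
    P' = Q + Abarᵀ * P * Abar - Abarᵀ * P * Bbar * M⁻¹ * Bbarᵀ * P * Abar
      ∧ P'.PosSemidef := by
  have hMpos : M.PosDef := by
    rw [hM]
    simpa only [conjTranspose_eq_transpose_of_trivial] using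
      hR.add_posSemidef (hP.conjTranspose_mul_mul_same Bbar)
  have hMK : R * K + Bbarᵀ * P * Bbar * K = Bbarᵀ * P * Abar := by
    rw [← Matrix.add_mul, ← hM, hK,
      mul_nonsing_inv_cancel_left _ _ ((isUnit_iff_isUnit_det M).mp hMpos.isUnit)]
  constructor
  · have hRK : R * K = Bbarᵀ * P * Abar - Bbarᵀ * P * Bbar * K := eq_sub_of_add_eq hMK
    have hgain : Abarᵀ * P * Bbar * M⁻¹ * Bbarᵀ * P * Abar = Abarᵀ * P * Bbar * K := by
      simp only [hK, Matrix.mul_assoc]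
    rw [hP', hgain, Matrix.mul_assoc Kᵀ, hRK]
    simp only [transpose_sub, transpose_mul, Matrix.mul_sub, Matrix.sub_mul, Matrix.mul_assoc]
    abel
  · rw [hP']
    simpa only [conjTranspose_eq_transpose_of_trivial] using
      (hQ.add (hR.posSemidef.conjTranspose_mul_mul_same K)).add
        (hP.conjTranspose_mul_mul_same (Abar - Bbar * K))
end

section
/- (Finite-horizon LQR verification theorem) Define the backward recursion: P_N = Q_N, p_N = q_N, c_N = 0, and for t = N−1,…,0: M_t = R_t + B̄_tᵀ P_{t+1} B̄_t, K_t = M_t⁻¹ B̄_tᵀ P_{t+1} Ā_t, ν_t = M_t⁻¹ B̄_tᵀ p_{t+1}, P_t = Q_t + K_tᵀ R_t K_t + (Ā_t − B̄_t K_t)ᵀ P_{t+1} (Ā_t − B̄_t K_t), p_t = q_t + K_tᵀ R_t ν_t + (Ā_t − B̄_t K_t)ᵀ (p_{t+1} − P_{t+1} B̄_t ν_t), c_t = c_{t+1} − p_{t+1}ᵀ B̄_t M_t⁻¹ B̄_tᵀ p_{t+1}. Then for every initial state z₀ ∈ ℝ^d and every input sequence u : Fin N → ℝ^m, with the trajectory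 z defined by z_{t+1} = Ā_t z_t + B̄_t u_t, the cost J(u) := Σ_{t=0}^{N−1} (z_tᵀ Q_t z_t + 2 q_tᵀ z_t + u_tᵀ R_t u_t) + z_Nᵀ Q_N z_N + 2 q_Nᵀ z_N satisfies J(u) ≥ z₀ᵀ P₀ z₀ + 2 p₀ᵀ z₀ + c₀, with equality if and only if u_t = −K_t z_t − ν_t for all t = 0,…,N−1. -/
open Matrix

namespace Matrix

variable {ι κ : Type*} [Fintype ι] [Fintype κ]

lemma IsSymm.dotProduct_mulVec_comm {S : Matrix ι ι ℝ} (hS : S.IsSymm) (x y : ι → ℝ) :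
    x ⬝ᵥ (S *ᵥ y) = y ⬝ᵥ (S *ᵥ x) := by
  rw [dotProduct_mulVec, ← mulVec_transpose, hS.eq, dotProduct_comm]

lemma PosDef.add_transpose_mul_mul {R : Matrix κ κ ℝ} {P : Matrix ι ι ℝ} (hR : R.PosDef)
    (hP : P.PosSemidef) (B : Matrix ι κ ℝ) : (R + Bᵀ * P * B).PosDef := by
  simpa using hR.add_posSemidef (hP.conjTranspose_mul_mul_same B)

/-- The feedback gain `K = M⁻¹ Bᵀ P A` balances the input cost against the closed-loop cost. -/
lemma mul_gain_eq [DecidableEq κ] {R M : Matrix κ κ ℝ} {A P : Matrix ι ι ℝ}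
    {B : Matrix ι κ ℝ} {K : Matrix κ ι ℝ} (hMdef : M.PosDef) (hM : M = R + Bᵀ * P * B)
    (hK : K = M⁻¹ * (Bᵀ * P * A)) : R * K = Bᵀ * P * (A - B * K) := by
  have hMK : M * K = Bᵀ * P * A := by
    rw [hK, mul_nonsing_inv_cancel_left _ _ ((isUnit_iff_isUnit_det M).mp hMdef.isUnit)]
  rw [hM, Matrix.add_mul] at hMK
  rw [Matrix.mul_sub, ← Matrix.mul_assoc _ B K, ← hMK, add_sub_cancel_right]

/-- Completing the square in one step of the Riccati recursion. -/
lemma riccati_step [DecidableEq κ] {Q A P P' : Matrix ι ι ℝ} {R M : Matrix κ κ ℝ}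
    {B : Matrix ι κ ℝ} {K : Matrix κ ι ℝ} {q p p' : ι → ℝ} {c c' : ℝ} {ν : κ → ℝ}
    (hR : R.PosDef) (hP' : P'.PosSemidef)
    (hM : M = R + Bᵀ * P' * B) (hK : K = M⁻¹ * (Bᵀ * P' * A))
    (hν : ν = M⁻¹ *ᵥ (Bᵀ *ᵥ p'))
    (hP : P = Q + Kᵀ * R * K + (A - B * K)ᵀ * P' * (A - B * K))
    (hp : p = q + Kᵀ *ᵥ (R *ᵥ ν) + (A - B * K)ᵀ *ᵥ (p' - P' *ᵥ (B *ᵥ ν)))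
    (hc : c = c' - p' ⬝ᵥ ((B * M⁻¹ * Bᵀ) *ᵥ p')) (z z' : ι → ℝ) (u : κ → ℝ)
    (hz : z' = A *ᵥ z + B *ᵥ u) :
    z ⬝ᵥ (Q *ᵥ z) + 2 * (q ⬝ᵥ z) + u ⬝ᵥ (R *ᵥ u)
        + (z' ⬝ᵥ (P' *ᵥ z') + 2 * (p' ⬝ᵥ z') + c')
      = z ⬝ᵥ (P *ᵥ z) + 2 * (p ⬝ᵥ z) + c
        + (u + K *ᵥ z + ν) ⬝ᵥ (M *ᵥ (u + K *ᵥ z + ν)) := by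
  have hMdef : M.PosDef := hM ▸ hR.add_transpose_mul_mul hP' B
  have hRs : R.IsSymm := isHermitian_iff_isSymm.mp hR.isHermitian
  have hPs : P'.IsSymm := isHermitian_iff_isSymm.mp hP'.isHermitian
  have hMs : M.IsSymm := isHermitian_iff_isSymm.mp hMdef.isHermitian
  have hMν : M *ᵥ ν = Bᵀ *ᵥ p' := by
    rw [hν, mulVec_mulVec, mul_nonsing_inv _ ((isUnit_iff_isUnit_det M).mp hMdef.isUnit),
      one_mulVec]
  set F := A - B * K with hF
  have hRK : R *ᵥ (K *ᵥ z) = Bᵀ *ᵥ (P' *ᵥ (F *ᵥ z)) := by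
    simp only [mulVec_mulVec, mul_gain_eq hMdef hM hK, Matrix.mul_assoc, hF]
  obtain ⟨y, rfl⟩ : ∃ y, u = y - K *ᵥ z := ⟨u + K *ᵥ z, by simp⟩
  have hz' : z' = F *ᵥ z + B *ᵥ y := by
    rw [hz, hF, sub_mulVec, mulVec_sub, mulVec_mulVec]; abel
  have hquad : z ⬝ᵥ (P *ᵥ z) = z ⬝ᵥ (Q *ᵥ z) + (K *ᵥ z) ⬝ᵥ (R *ᵥ (K *ᵥ z))
      + (F *ᵥ z) ⬝ᵥ (P' *ᵥ (F *ᵥ z)) := by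
    simp only [hP, add_mulVec, dotProduct_add, ← mulVec_mulVec, dotProduct_transpose_mulVec]
    rw [dotProduct_comm (R *ᵥ _), dotProduct_comm (P' *ᵥ _)]
  have hcross (v : κ → ℝ) : v ⬝ᵥ (R *ᵥ (K *ᵥ z)) = (F *ᵥ z) ⬝ᵥ (P' *ᵥ (B *ᵥ v)) := by
    rw [hRK, dotProduct_transpose_mulVec, hPs.dotProduct_mulVec_comm, dotProduct_comm]
  have hlin : p ⬝ᵥ z = q ⬝ᵥ z + p' ⬝ᵥ (F *ᵥ z) := by
    rw [dotProduct_comm p, hp]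
    simp only [dotProduct_add, dotProduct_transpose_mulVec, sub_dotProduct]
    rw [dotProduct_comm (R *ᵥ _), hRs.dotProduct_mulVec_comm, hcross, dotProduct_comm z q,
      dotProduct_comm (P' *ᵥ _)]
    ring
  have hconst : c = c' - p' ⬝ᵥ (B *ᵥ ν) := by
    rw [hc, hν]; simp only [mulVec_mulVec, Matrix.mul_assoc]
  have hMquad (v : κ → ℝ) :
      v ⬝ᵥ (M *ᵥ v) = v ⬝ᵥ (R *ᵥ v) + (B *ᵥ v) ⬝ᵥ (P' *ᵥ (B *ᵥ v)) := by
    simp only [hM, add_mulVec, dotProduct_add, ← mulVec_mulVec, dotProduct_transpose_mulVec]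
    rw [dotProduct_comm (P' *ᵥ _)]
  have hMlin (v : κ → ℝ) : v ⬝ᵥ (M *ᵥ ν) = p' ⬝ᵥ (B *ᵥ v) := by
    rw [hMν, dotProduct_transpose_mulVec]
  rw [hz', hquad, hlin, hconst, sub_add_cancel]
  simp only [mulVec_add, mulVec_sub, add_dotProduct, sub_dotProduct, dotProduct_add,
    dotProduct_sub]
  rw [hRs.dotProduct_mulVec_comm (K *ᵥ z) y, hcross y,
    hPs.dotProduct_mulVec_comm (B *ᵥ y) (F *ᵥ z), hMs.dotProduct_mulVec_comm ν y, hMlin, hMlin,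
    hMquad]
  ring

end Matrix

lemma Fin.sum_univ_succ_sub_castSucc {G : Type*} [AddCommGroup G] {n : ℕ}
    (f : Fin (n + 1) → G) :
    ∑ i : Fin n, (f i.succ - f i.castSucc) = f (Fin.last n) - f 0 := by
  have h := (Fin.sum_univ_succ f).symm.trans (Fin.sum_univ_castSucc f)
  rw [Finset.sum_sub_distrib, sub_eq_sub_iff_add_eq_add, add_comm, h, add_comm]

/-- (Finite-horizon LQR verification theorem) With `P, p, c, M, K, ν` defined by the
backward Riccati recursion `P_N = Q_N`, `p_N = q_N`, `c_N = 0`,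
`M_t = R_t + B̄_tᵀ P_{t+1} B̄_t`, `K_t = M_t⁻¹ B̄_tᵀ P_{t+1} Ā_t`,
`ν_t = M_t⁻¹ B̄_tᵀ p_{t+1}`,
`P_t = Q_t + K_tᵀ R_t K_t + (Ā_t − B̄_t K_t)ᵀ P_{t+1} (Ā_t − B̄_t K_t)`,
`p_t = q_t + K_tᵀ R_t ν_t + (Ā_t − B̄_t K_t)ᵀ (p_{t+1} − P_{t+1} B̄_t ν_t)`,
`c_t = c_{t+1} − p_{t+1}ᵀ B̄_t M_t⁻¹ B̄_tᵀ p_{t+1}`,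
every trajectory `z` generated from `z₀` by an input sequence `u` via
`z_{t+1} = Ā_t z_t + B̄_t u_t` has cost
`J(u) = Σ_{t<N} (z_tᵀQ_tz_t + 2q_tᵀz_t + u_tᵀR_tu_t) + z_NᵀQ_Nz_N + 2q_Nᵀz_N`
at least `z₀ᵀP₀z₀ + 2p₀ᵀz₀ + c₀`, with equality iff `u_t = −K_t z_t − ν_t` for all `t`. -/
theorem finite_horizon_lqr_verification
    (d m N : ℕ) (hd : 0 < d) (hm : 0 < m) (hN : 0 < N)
    (Q : Fin (N + 1) → Matrix (Fin d) (Fin d) ℝ) (hQ : ∀ t, (Q t).PosSemidef)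
    (q : Fin (N + 1) → Fin d → ℝ)
    (R : Fin N → Matrix (Fin m) (Fin m) ℝ) (hR : ∀ t, (R t).PosDef)
    (Abar : Fin N → Matrix (Fin d) (Fin d) ℝ)
    (Bbar : Fin N → Matrix (Fin d) (Fin m) ℝ)
    (P : Fin (N + 1) → Matrix (Fin d) (Fin d) ℝ)
    (p : Fin (N + 1) → Fin d → ℝ)
    (c : Fin (N + 1) → ℝ)
    (M : Fin N → Matrix (Fin m) (Fin m) ℝ)
    (K : Fin N → Matrix (Fin m) (Fin d) ℝ)
    (ν : Fin N → Fin m → ℝ)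
    (hPN : P (Fin.last N) = Q (Fin.last N))
    (hpN : p (Fin.last N) = q (Fin.last N))
    (hcN : c (Fin.last N) = 0)
    (hM : ∀ t : Fin N, M t = R t + (Bbar t)ᵀ * P t.succ * Bbar t)
    (hK : ∀ t : Fin N, K t = (M t)⁻¹ * ((Bbar t)ᵀ * P t.succ * Abar t))
    (hν : ∀ t : Fin N, ν t = (M t)⁻¹ *ᵥ ((Bbar t)ᵀ *ᵥ p t.succ))
    (hP : ∀ t : Fin N, P t.castSucc =
      Q t.castSucc + (K t)ᵀ * R t * K t
        + (Abar t - Bbar t * K t)ᵀ * P t.succ * (Abar t - Bbar t * K t))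
    (hp : ∀ t : Fin N, p t.castSucc =
      q t.castSucc + (K t)ᵀ *ᵥ (R t *ᵥ ν t)
        + (Abar t - Bbar t * K t)ᵀ *ᵥ (p t.succ - P t.succ *ᵥ (Bbar t *ᵥ ν t)))
    (hc : ∀ t : Fin N, c t.castSucc =
      c t.succ - p t.succ ⬝ᵥ ((Bbar t * (M t)⁻¹ * (Bbar t)ᵀ) *ᵥ p t.succ)) :
    ∀ (z : Fin (N + 1) → Fin d → ℝ) (u : Fin N → Fin m → ℝ),
      (∀ t : Fin N, z t.succ = Abar t *ᵥ z t.castSucc + Bbar t *ᵥ u t) →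
      (∑ t : Fin N, (z t.castSucc ⬝ᵥ (Q t.castSucc *ᵥ z t.castSucc)
            + 2 * (q t.castSucc ⬝ᵥ z t.castSucc) + u t ⬝ᵥ (R t *ᵥ u t))
          + z (Fin.last N) ⬝ᵥ (Q (Fin.last N) *ᵥ z (Fin.last N))
          + 2 * (q (Fin.last N) ⬝ᵥ z (Fin.last N))
        ≥ z 0 ⬝ᵥ (P 0 *ᵥ z 0) + 2 * (p 0 ⬝ᵥ z 0) + c 0) ∧
      ((∑ t : Fin N, (z t.castSucc ⬝ᵥ (Q t.castSucc *ᵥ z t.castSucc)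
            + 2 * (q t.castSucc ⬝ᵥ z t.castSucc) + u t ⬝ᵥ (R t *ᵥ u t))
          + z (Fin.last N) ⬝ᵥ (Q (Fin.last N) *ᵥ z (Fin.last N))
          + 2 * (q (Fin.last N) ⬝ᵥ z (Fin.last N))
        = z 0 ⬝ᵥ (P 0 *ᵥ z 0) + 2 * (p 0 ⬝ᵥ z 0) + c 0)
        ↔ ∀ t : Fin N, u t = -(K t *ᵥ z t.castSucc) - ν t) := by
  intro z u hz
  have hPpos (t : Fin (N + 1)) : (P t).PosSemidef := by
    induction t using Fin.reverseInduction with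
    | last => exact hPN ▸ hQ _
    | cast t ih =>
      rw [hP]
      simpa using ((hQ t.castSucc).add ((hR t).posSemidef.conjTranspose_mul_mul_same (K t))).add
        (ih.conjTranspose_mul_mul_same (Abar t - Bbar t * K t))
  have hMpos (t : Fin N) : (M t).PosDef :=
    hM t ▸ (hR t).add_transpose_mul_mul (hPpos t.succ) (Bbar t)
  let V (t : Fin (N + 1)) : ℝ := z t ⬝ᵥ (P t *ᵥ z t) + 2 * (p t ⬝ᵥ z t) + c t
  let w (t : Fin N) : Fin m → ℝ := u t + K t *ᵥ z t.castSucc + ν t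
  have hcost : ∑ t : Fin N, (z t.castSucc ⬝ᵥ (Q t.castSucc *ᵥ z t.castSucc)
            + 2 * (q t.castSucc ⬝ᵥ z t.castSucc) + u t ⬝ᵥ (R t *ᵥ u t))
          + z (Fin.last N) ⬝ᵥ (Q (Fin.last N) *ᵥ z (Fin.last N))
          + 2 * (q (Fin.last N) ⬝ᵥ z (Fin.last N))
      = z 0 ⬝ᵥ (P 0 *ᵥ z 0) + 2 * (p 0 ⬝ᵥ z 0) + c 0 + ∑ t, w t ⬝ᵥ (M t *ᵥ w t) := by
    have hstage (t : Fin N) : z t.castSucc ⬝ᵥ (Q t.castSucc *ᵥ z t.castSucc)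
        + 2 * (q t.castSucc ⬝ᵥ z t.castSucc) + u t ⬝ᵥ (R t *ᵥ u t)
        = w t ⬝ᵥ (M t *ᵥ w t) - (V t.succ - V t.castSucc) := by
      linear_combination riccati_step (hR t) (hPpos t.succ) (hM t) (hK t) (hν t) (hP t) (hp t)
        (hc t) _ _ _ (hz t)
    rw [Finset.sum_congr rfl fun t _ => hstage t, Finset.sum_sub_distrib,
      Fin.sum_univ_succ_sub_castSucc]
    simp only [V, hPN, hpN, hcN]
    ring
  have hnonneg (t : Fin N) : 0 ≤ w t ⬝ᵥ (M t *ᵥ w t) := by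
    simpa using (hMpos t).posSemidef.dotProduct_mulVec_nonneg (w t)
  have hzero (t : Fin N) :
      w t ⬝ᵥ (M t *ᵥ w t) = 0 ↔ u t = -(K t *ᵥ z t.castSucc) - ν t := by
    have hw : w t = 0 ↔ u t = -(K t *ᵥ z t.castSucc) - ν t := by
      rw [← sub_eq_zero (a := u t)]
      simp only [w, sub_eq_add_neg, neg_add, neg_neg, add_assoc]
    rw [← hw]
    refine ⟨fun h => ?_, fun h => by simp [h]⟩
    by_contra hne
    exact absurd h (by simpa using ((hMpos t).dotProduct_mulVec_pos hne).ne')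
  rw [hcost]
  refine ⟨le_add_of_nonneg_right (Finset.sum_nonneg fun t _ => hnonneg t), ?_⟩
  rw [add_eq_left, Finset.sum_eq_zero_iff_of_nonneg fun t _ => hnonneg t]
  simp only [Finset.mem_univ, true_imp_iff, hzero]
end

section
/- (ADMM convergence for the linear OCP yields the optimal value of the original problem) Consider ADMM iterates: sequences r^k, x^k : Fin (N+1) → ℝ^n, u^k : Fin N → ℝ^m, v^k : Fin (N+1) → ℝ^n, with arbitrary initialization (x⁰, u⁰, v⁰), such that for every k: (i) r^{k+1} minimizes C_x(r) + (ρ/2)‖x^k − r + v^k‖² over all r with r_t ∈ 𝓡 for t = 0,…,N−1; (ii) (x^{k+1}, u^{k+1}) minimizes (ρ/2)‖x − r^{k+1} + v^k‖² + Σ_{t=0}^{N−1} u_tᵀ R_t u_t over all (x, u) with x₀ = ξ and x_{t+1} = A_t x_t + B_t u_t for t = 0,…,N−1; (iii) v^{k+1} = v^k + x^{k+1} − r^{k+1}. Assume the Lagrangian of the redundant-variable problem has a saddle point. Then x^k − r^k → 0 and C_x(r^k) + Σ_{t=0}^{N−1} (u^k_t)ᵀ R_t u^k_t → p⋆, where p⋆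 is the optimal value of the original problem: minimize C_x(x) + Σ_{t=0}^{N−1} u_tᵀ R_t u_t over (x, u) with x₀ = ξ, x_{t+1} = A_t x_t + B_t u_t, and x_t ∈ 𝓡 for t = 0,…,N−1. -/
open Matrix Filter Topology

open scoped InnerProductSpace

/-- First-order optimality condition for a convex function plus a quadratic penalty. -/
theorem ConvexOn.le_add_inner_of_isMinOn_add_sq {W E : Type*} [AddCommGroup W] [Module ℝ W]
    [NormedAddCommGroup E] [InnerProductSpace ℝ E] {S : Set W} {f : W → ℝ}
    (hf : ConvexOn ℝ S f) (M : W →ₗ[ℝ] E) (c : E) (ρ : ℝ) {a b : W} (ha : a ∈ S) (hb : b ∈ S)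
    (hmin : ∀ w ∈ S, f a + ρ / 2 * ‖M a - c‖ ^ 2 ≤ f w + ρ / 2 * ‖M w - c‖ ^ 2) :
    f a ≤ f b + ρ * ⟪M a - c, M b - M a⟫_ℝ := by
  have key : ∀ t ∈ Set.Ioo (0 : ℝ) 1,
      f a ≤ f b + ρ * ⟪M a - c, M b - M a⟫_ℝ + t * (ρ / 2 * ‖M b - M a‖ ^ 2) := by
    rintro t ⟨ht0, ht1⟩
    have hmem := hf.1 ha hb (sub_nonneg.2 ht1.le) ht0.le (sub_add_cancel 1 t)
    have hconv := hf.2 ha hb (sub_nonneg.2 ht1.le) ht0.le (sub_add_cancel 1 t)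
    have hle := hmin _ hmem
    have hM : M ((1 - t) • a + t • b) - c = (M a - c) + t • (M b - M a) := by
      simp only [map_add, map_smul]
      module
    rw [hM, norm_add_sq_real, real_inner_smul_right, norm_smul, mul_pow, Real.norm_eq_abs,
      sq_abs] at hle
    simp only [smul_eq_mul] at hconv
    refine le_of_mul_le_mul_left ?_ ht0
    linarith
  have hlim : Tendsto (fun t : ℝ => f b + ρ * ⟪M a - c, M b - M a⟫_ℝ
      + t * (ρ / 2 * ‖M b - M a‖ ^ 2)) (𝓝[>] 0) (𝓝 (f b + ρ * ⟪M a - c, M b - M a⟫_ℝ)) := by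
    refine tendsto_nhdsWithin_of_tendsto_nhds (Continuous.tendsto' (by fun_prop) _ _ (by simp))
  refine ge_of_tendsto hlim ?_
  filter_upwards [Ioo_mem_nhdsGT (zero_lt_one' ℝ)] with t ht using key t ht

/-- A nonnegative sequence controlled by the decrements of a nonnegative sequence tends to `0`. -/
theorem tendsto_zero_of_add_le {V d : ℕ → ℝ} (hV : ∀ k, 0 ≤ V k) (hd : ∀ k, 0 ≤ d k)
    (h : ∀ k, V (k + 1) + d k ≤ V k) : Tendsto d atTop (𝓝 0) := by
  refine (summable_of_sum_range_le (c := V 0) hd fun n => ?_).tendsto_atTop_zero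
  have hsum : ∑ i ∈ Finset.range n, d i + V n ≤ V 0 := by
    induction n with
    | zero => simp
    | succ n ih =>
      rw [Finset.sum_range_succ]
      linarith [h n]
  linarith [hV n]

/-- Convergence of the residual and of the objective for scaled ADMM applied to the minimization of
`f r + g z` over `r ∈ S`, `z ∈ T` subject to `L z = M r`. -/
theorem admm_tendsto {W F E : Type*} [AddCommGroup W] [Module ℝ W] [AddCommGroup F] [Module ℝ F]
    [NormedAddCommGroup E] [InnerProductSpace ℝ E] {S : Set W} {T : Set F} {f : W → ℝ} {g : F → ℝ}
    (hf : ConvexOn ℝ S f) (hg : ConvexOn ℝ T g) (M : W →ₗ[ℝ] E) (L : F →ₗ[ℝ] E)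
    {ρ : ℝ} (hρ : 0 < ρ) {r : ℕ → W} {z : ℕ → F} {v : ℕ → E}
    (hrS : ∀ k, r (k + 1) ∈ S) (hzT : ∀ k, z (k + 1) ∈ T)
    (hr : ∀ k, ∀ w ∈ S, f (r (k + 1)) + ρ / 2 * ‖L (z k) - M (r (k + 1)) + v k‖ ^ 2
      ≤ f w + ρ / 2 * ‖L (z k) - M w + v k‖ ^ 2)
    (hz : ∀ k, ∀ w ∈ T, ρ / 2 * ‖L (z (k + 1)) - M (r (k + 1)) + v k‖ ^ 2 + g (z (k + 1))
      ≤ ρ / 2 * ‖L w - M (r (k + 1)) + v k‖ ^ 2 + g w)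
    (hv : ∀ k, v (k + 1) = v k + L (z (k + 1)) - M (r (k + 1)))
    {rs : W} {zs : F} {y : E} (hrs : rs ∈ S) (hzs : zs ∈ T) (hfeas : L zs = M rs)
    (hsaddle : ∀ w ∈ S, ∀ q ∈ T, f rs + g zs ≤ f w + g q + ⟪y, L q - M w⟫_ℝ) :
    Tendsto (fun k => L (z k) - M (r k)) atTop (𝓝 0) ∧
      Tendsto (fun k => f (r k) + g (z k)) atTop (𝓝 (f rs + g zs)) := by
  have hr' : ∀ k, ∀ w ∈ S, f (r (k + 1)) ≤
      f w + ρ * ⟪M (r (k + 1)) - (L (z k) + v k), M w - M (r (k + 1))⟫_ℝ := by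
    intro k w hw
    refine hf.le_add_inner_of_isMinOn_add_sq M _ ρ (hrS k) hw fun q hq => ?_
    have := hr k q hq
    rwa [← norm_neg, ← norm_neg (L (z k) - M q + v k),
      show -(L (z k) - M (r (k + 1)) + v k) = M (r (k + 1)) - (L (z k) + v k) by abel,
      show -(L (z k) - M q + v k) = M q - (L (z k) + v k) by abel] at this
  have hz' : ∀ k, ∀ w ∈ T, g (z (k + 1)) ≤
      g w + ρ * ⟪v (k + 1), L w - L (z (k + 1))⟫_ℝ := by
    intro k w hw
    have := hg.le_add_inner_of_isMinOn_add_sq L (M (r (k + 1)) - v k) ρ (hzT k) hw fun q hq => by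
      have := hz k q hq
      rw [← sub_add, ← sub_add]
      linarith
    rwa [show L (z (k + 1)) - (M (r (k + 1)) - v k) = v (k + 1) by rw [hv]; abel] at this
  set vs : E := ρ⁻¹ • y with hvs
  have hy : y = ρ • vs := by rw [hvs, smul_smul, mul_inv_cancel₀ hρ.ne', one_smul]
  set e : ℕ → E := fun k => v (k + 1) - v k with he
  set d : ℕ → E := fun k => L (z k) - L (z (k + 1)) with hd
  have hee : ∀ k, L (z (k + 1)) - M (r (k + 1)) = e k := fun k => by
    simp only [he, hv k]; abel
  have hMr : ∀ k, M (r (k + 1)) = L (z (k + 1)) - e k := fun k => by rw [← hee k]; abel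
  have lower : ∀ k, f rs + g zs ≤ f (r (k + 1)) + g (z (k + 1)) + ρ * ⟪vs, e k⟫_ℝ := by
    intro k
    have := hsaddle _ (hrS k) _ (hzT k)
    rwa [hee, hy, real_inner_smul_left] at this
  have upper : ∀ k, f (r (k + 1)) + g (z (k + 1)) ≤ f rs + g zs
      + ρ * (⟪d k, L (z (k + 1)) - L zs - e k⟫_ℝ - ⟪v (k + 1), e k⟫_ℝ) := by
    intro k
    have h1 := hr' k rs hrs
    have h2 := hz' k zs hzs
    have h3 : M (r (k + 1)) - (L (z k) + v k) = -(v (k + 1) + d k) := by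
      rw [hMr]; simp only [he, hd]; abel
    have h4 : M rs - M (r (k + 1)) = e k - (L (z (k + 1)) - L zs) := by
      rw [hMr, hfeas]; abel
    have h5 : L zs - L (z (k + 1)) = -(L (z (k + 1)) - L zs) := by abel
    rw [h3, h4] at h1
    rw [h5] at h2
    simp only [inner_neg_left, inner_neg_right, inner_add_left, inner_sub_right] at h1 h2 ⊢
    linarith
  have mono : ∀ k, 0 ≤ ⟪e (k + 1), d (k + 1)⟫_ℝ := by
    intro k
    have h1 := hz' (k + 1) _ (hzT k)
    have h2 := hz' k _ (hzT (k + 1))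
    have h3 : L (z (k + 1 + 1)) - L (z (k + 1)) = -d (k + 1) := by simp only [hd]; abel
    have h4 : L (z (k + 1)) - L (z (k + 1 + 1)) = d (k + 1) := rfl
    rw [h4] at h1
    rw [h3, inner_neg_right] at h2
    have h5 : ⟪e (k + 1), d (k + 1)⟫_ℝ
        = ⟪v (k + 1 + 1), d (k + 1)⟫_ℝ - ⟪v (k + 1), d (k + 1)⟫_ℝ := inner_sub_left _ _ _
    rw [h5]
    refine nonneg_of_mul_nonneg_right ?_ hρ
    linarith
  set V : ℕ → ℝ := fun k => ‖v (k + 1) - vs‖ ^ 2 + ‖L (z (k + 1)) - L zs‖ ^ 2 with hV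
  have hdec : ∀ k, V (k + 1) + (‖e (k + 1)‖ ^ 2 + ‖d (k + 1)‖ ^ 2) ≤ V k := by
    intro k
    have h1 := lower (k + 1)
    have h2 := upper (k + 1)
    have h3 := mono k
    have h4 : 0 ≤ ⟪d (k + 1), L (z (k + 1 + 1)) - L zs - e (k + 1)⟫_ℝ
        - ⟪v (k + 1 + 1), e (k + 1)⟫_ℝ + ⟪vs, e (k + 1)⟫_ℝ := by
      refine nonneg_of_mul_nonneg_right ?_ hρ
      linarith
    have h5 : v (k + 1) - vs = (v (k + 1 + 1) - vs) - e (k + 1) := by simp only [he]; abel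
    have h6 : L (z (k + 1)) - L zs = (L (z (k + 1 + 1)) - L zs) + d (k + 1) := by
      simp only [hd]; abel
    simp only [hV]
    rw [h5, h6, norm_sub_sq_real (v (k + 1 + 1) - vs), norm_add_sq_real, inner_sub_left]
    rw [inner_sub_right, real_inner_comm (L (z (k + 1 + 1)) - L zs),
      real_inner_comm (e (k + 1)) (d (k + 1))] at h4
    linarith
  have hV0 : ∀ k, 0 ≤ V k := fun k => by positivity
  have hlim := tendsto_zero_of_add_le hV0 (fun k => by positivity) hdec
  have hnorm : ∀ {s : ℕ → E}, (∀ k, ‖s (k + 1)‖ ^ 2 ≤ ‖e (k + 1)‖ ^ 2 + ‖d (k + 1)‖ ^ 2) →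
      Tendsto s atTop (𝓝 0) := by
    intro s hs
    rw [← tendsto_add_atTop_iff_nat 1, tendsto_zero_iff_norm_tendsto_zero]
    have := (squeeze_zero (fun k => sq_nonneg _) hs hlim).sqrt
    simpa using this
  have he0 : Tendsto e atTop (𝓝 0) := hnorm fun k => le_add_of_nonneg_right (sq_nonneg _)
  have hd0 : Tendsto d atTop (𝓝 0) := hnorm fun k => le_add_of_nonneg_left (sq_nonneg _)
  have hVb : ∀ k, V k ≤ V 0 := fun k => antitone_nat_of_succ_le
    (fun k => (le_add_of_nonneg_right (by positivity)).trans (hdec k)) (Nat.zero_le k)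
  have hzb : ∀ k, ‖L (z (k + 1)) - L zs‖ ≤ √(V 0) := fun k =>
    Real.le_sqrt_of_sq_le ((le_add_of_nonneg_left (sq_nonneg _)).trans (hVb k))
  have hvb : ∀ k, ‖v (k + 1) - vs‖ ≤ √(V 0) := fun k =>
    Real.le_sqrt_of_sq_le ((le_add_of_nonneg_right (sq_nonneg _)).trans (hVb k))
  have hinner : ∀ {s b : ℕ → E} {C : ℝ}, Tendsto s atTop (𝓝 0) → (∀ k, ‖b k‖ ≤ C) →
      Tendsto (fun k => ⟪s k, b k⟫_ℝ) atTop (𝓝 0) := by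
    intro s b C hs hb
    refine squeeze_zero_norm (a := fun k => ‖s k‖ * C) (fun k => (norm_inner_le_norm _ _).trans
      (mul_le_mul_of_nonneg_left (hb k) (norm_nonneg _))) ?_
    simpa using hs.norm.mul_const C
  constructor
  · rw [← tendsto_add_atTop_iff_nat 1]
    simpa only [hee] using he0
  · rw [← tendsto_add_atTop_iff_nat 1]
    have hvse : Tendsto (fun k => ⟪vs, e k⟫_ℝ) atTop (𝓝 0) := by
      simpa using (tendsto_const_nhds (x := vs)).inner (𝕜 := ℝ) he0
    have hve : Tendsto (fun k => ⟪v (k + 1), e k⟫_ℝ) atTop (𝓝 0) := by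
      have := (hinner he0 hvb).add hvse
      simp only [add_zero] at this
      refine this.congr fun k => ?_
      rw [inner_sub_right, real_inner_comm vs, real_inner_comm (v (k + 1)), sub_add_cancel]
    have hdz : Tendsto (fun k => ⟪d k, L (z (k + 1)) - L zs - e k⟫_ℝ) atTop (𝓝 0) := by
      have := (hinner hd0 hzb).sub (hd0.inner (𝕜 := ℝ) he0)
      simp only [inner_zero_left, sub_zero] at this
      exact this.congr fun k => (inner_sub_right _ _ _).symm
    refine tendsto_of_tendsto_of_tendsto_of_le_of_le
      (g := fun k => f rs + g zs - ρ * ⟪vs, e k⟫_ℝ) ?_ ?_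
      (fun k => by linarith [lower k]) upper
    · simpa using (hvse.const_mul ρ).const_sub (f rs + g zs)
    · simpa using ((hdz.sub hve).const_mul ρ).const_add (f rs + g zs)

/-- The quadratic form of a positive semidefinite matrix is convex. -/
theorem Matrix.PosSemidef.convexOn_dotProduct_mulVec {m : Type*} [Fintype m] {R : Matrix m m ℝ}
    (hR : R.PosSemidef) : ConvexOn ℝ Set.univ fun u : m → ℝ => u ⬝ᵥ (R *ᵥ u) := by
  refine ⟨convex_univ, fun p _ q _ a b ha hb hab => ?_⟩
  have h := hR.dotProduct_mulVec_nonneg (p - q)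
  have hb' : b = 1 - a := by linarith
  subst hb'
  simp only [star_trivial, Matrix.mulVec_sub, Matrix.mulVec_add, Matrix.mulVec_smul,
    dotProduct_sub, sub_dotProduct, dotProduct_add, add_dotProduct, dotProduct_smul,
    smul_dotProduct, smul_eq_mul] at h ⊢
  nlinarith [mul_nonneg (mul_nonneg ha hb) h]

/-- Flattening of a trajectory into Euclidean space. -/
noncomputable def trajectoryToEuclidean (N n : ℕ) :
    (Fin (N + 1) → Fin n → ℝ) →ₗ[ℝ] EuclideanSpace ℝ (Fin (N + 1) × Fin n) where
  toFun a := WithLp.toLp 2 fun p => a p.1 p.2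
  map_add' _ _ := rfl
  map_smul' _ _ := rfl

theorem trajectoryToEuclidean_apply {N n : ℕ} (a : Fin (N + 1) → Fin n → ℝ)
    (p : Fin (N + 1) × Fin n) : trajectoryToEuclidean N n a p = a p.1 p.2 := rfl

theorem norm_sq_trajectoryToEuclidean {N n : ℕ} (a : Fin (N + 1) → Fin n → ℝ) :
    ‖trajectoryToEuclidean N n a‖ ^ 2 = ∑ t, ∑ i, a t i ^ 2 := by
  simp [EuclideanSpace.norm_sq_eq, trajectoryToEuclidean_apply, Fintype.sum_prod_type]

theorem inner_trajectoryToEuclidean {N n : ℕ} (a b : Fin (N + 1) → Fin n → ℝ) :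
    ⟪trajectoryToEuclidean N n a, trajectoryToEuclidean N n b⟫_ℝ = ∑ t, a t ⬝ᵥ b t := by
  simp [PiLp.inner_apply, trajectoryToEuclidean_apply, Fintype.sum_prod_type, dotProduct, mul_comm]

/-- (ADMM convergence for the linear OCP yields the optimal value of the original
problem) For ADMM iterates on the redundant-variable linear optimal control problem —
(i) `r^{k+1}` minimizes `C_x(r) + (ρ/2)‖x^k − r + v^k‖²` over `r` with `r_t ∈ 𝓡`,
(ii) `(x^{k+1}, u^{k+1})` minimizes `(ρ/2)‖x − r^{k+1} + v^k‖² + Σ u_tᵀR_tu_t` over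
dynamically feasible `(x, u)`, (iii) `v^{k+1} = v^k + x^{k+1} − r^{k+1}` — if the
Lagrangian of the redundant-variable problem has a saddle point, then `x^k − r^k → 0`
and `C_x(r^k) + Σ (u^k_t)ᵀR_tu^k_t → p⋆`, the optimal value of the original problem. -/
theorem admm_linear_ocp_convergence
    (n m N : ℕ) (hn : 0 < n) (hm : 0 < m) (hN : 0 < N)
    (ξ : Fin n → ℝ)
    (A : Fin N → Matrix (Fin n) (Fin n) ℝ)
    (B : Fin N → Matrix (Fin n) (Fin m) ℝ)
    (R : Fin N → Matrix (Fin m) (Fin m) ℝ) (hR : ∀ t, (R t).PosDef)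
    (ρ : ℝ) (hρ : 0 < ρ)
    (𝓡 : Set (Fin n → ℝ)) (h𝓡ne : 𝓡.Nonempty) (h𝓡cl : IsClosed 𝓡)
    (h𝓡cv : Convex ℝ 𝓡)
    (Cx : (Fin (N + 1) → Fin n → ℝ) → ℝ)
    (hCx_cv : ConvexOn ℝ Set.univ Cx) (hCx_lsc : LowerSemicontinuous Cx)
    -- ADMM iterates (arbitrary initialization (x⁰, u⁰, v⁰))
    (r x v : ℕ → Fin (N + 1) → Fin n → ℝ) (u : ℕ → Fin N → Fin m → ℝ)
    -- (i) the r-update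
    (hr_feas : ∀ (k : ℕ) (t : Fin N), r (k + 1) t.castSucc ∈ 𝓡)
    (hr_min : ∀ (k : ℕ) (r' : Fin (N + 1) → Fin n → ℝ),
      (∀ t : Fin N, r' t.castSucc ∈ 𝓡) →
      Cx (r (k + 1)) +
          (ρ / 2) * ∑ t : Fin (N + 1), ∑ i, (x k t i - r (k + 1) t i + v k t i) ^ 2
        ≤ Cx r' + (ρ / 2) * ∑ t : Fin (N + 1), ∑ i, (x k t i - r' t i + v k t i) ^ 2)
    -- (ii) the (x, u)-update
    (hx0 : ∀ k : ℕ, x (k + 1) 0 = ξ)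
    (hxdyn : ∀ (k : ℕ) (t : Fin N),
      x (k + 1) t.succ = A t *ᵥ x (k + 1) t.castSucc + B t *ᵥ u (k + 1) t)
    (hxu_min : ∀ (k : ℕ) (x' : Fin (N + 1) → Fin n → ℝ) (u' : Fin N → Fin m → ℝ),
      x' 0 = ξ →
      (∀ t : Fin N, x' t.succ = A t *ᵥ x' t.castSucc + B t *ᵥ u' t) →
      (ρ / 2) * ∑ t : Fin (N + 1), ∑ i, (x (k + 1) t i - r (k + 1) t i + v k t i) ^ 2
          + ∑ t : Fin N, u (k + 1) t ⬝ᵥ (R t *ᵥ u (k + 1) t)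
        ≤ (ρ / 2) * ∑ t : Fin (N + 1), ∑ i, (x' t i - r (k + 1) t i + v k t i) ^ 2
          + ∑ t : Fin N, u' t ⬝ᵥ (R t *ᵥ u' t))
    -- (iii) the dual update
    (hv : ∀ k : ℕ, v (k + 1) = v k + x (k + 1) - r (k + 1))
    -- saddle point of the Lagrangian of the redundant-variable problem
    (hsaddle : ∃ (rs xs : Fin (N + 1) → Fin n → ℝ) (us : Fin N → Fin m → ℝ)
        (ys : Fin (N + 1) → Fin n → ℝ),
      xs 0 = ξ ∧
      (∀ t : Fin N, xs t.succ = A t *ᵥ xs t.castSucc + B t *ᵥ us t) ∧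
      (∀ t : Fin N, rs t.castSucc ∈ 𝓡) ∧
      (∀ y : Fin (N + 1) → Fin n → ℝ,
        Cx rs + ∑ t : Fin N, us t ⬝ᵥ (R t *ᵥ us t)
            + ∑ t : Fin (N + 1), y t ⬝ᵥ (xs t - rs t)
          ≤ Cx rs + ∑ t : Fin N, us t ⬝ᵥ (R t *ᵥ us t)
            + ∑ t : Fin (N + 1), ys t ⬝ᵥ (xs t - rs t)) ∧
      (∀ (r' x' : Fin (N + 1) → Fin n → ℝ) (u' : Fin N → Fin m → ℝ),
        x' 0 = ξ →
        (∀ t : Fin N, x' t.succ = A t *ᵥ x' t.castSucc + B t *ᵥ u' t) →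
        (∀ t : Fin N, r' t.castSucc ∈ 𝓡) →
        Cx rs + ∑ t : Fin N, us t ⬝ᵥ (R t *ᵥ us t)
            + ∑ t : Fin (N + 1), ys t ⬝ᵥ (xs t - rs t)
          ≤ Cx r' + ∑ t : Fin N, u' t ⬝ᵥ (R t *ᵥ u' t)
            + ∑ t : Fin (N + 1), ys t ⬝ᵥ (x' t - r' t))) :
    Tendsto (fun k => x k - r k) atTop (𝓝 0) ∧
    Tendsto (fun k => Cx (r k) + ∑ t : Fin N, u k t ⬝ᵥ (R t *ᵥ u k t)) atTop
      (𝓝 (sInf {val : ℝ | ∃ (x' : Fin (N + 1) → Fin n → ℝ) (u' : Fin N → Fin m → ℝ),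
        x' 0 = ξ ∧
        (∀ t : Fin N, x' t.succ = A t *ᵥ x' t.castSucc + B t *ᵥ u' t) ∧
        (∀ t : Fin N, x' t.castSucc ∈ 𝓡) ∧
        val = Cx x' + ∑ t : Fin N, u' t ⬝ᵥ (R t *ᵥ u' t)})) := by
  obtain ⟨rs, xs, us, ys, hxs0, hxsdyn, hrs, hmax, hmin⟩ := hsaddle
  have hxr : xs = rs := by
    have h := hmax (ys + (xs - rs))
    simp only [Pi.add_apply, add_dotProduct, Finset.sum_add_distrib, Pi.sub_apply] at h
    have h0 : ∀ t, 0 ≤ (xs t - rs t) ⬝ᵥ (xs t - rs t) := fun t =>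
      Finset.sum_nonneg fun i _ => mul_self_nonneg _
    have hs : ∑ t, (xs t - rs t) ⬝ᵥ (xs t - rs t) = 0 :=
      le_antisymm (by linarith) (Finset.sum_nonneg fun t _ => h0 t)
    rw [Finset.sum_eq_zero_iff_of_nonneg fun t _ => h0 t] at hs
    funext t
    exact sub_eq_zero.1 (dotProduct_self_eq_zero.1 (hs t (Finset.mem_univ t)))
  subst hxr
  simp only [sub_self, dotProduct_zero, Finset.sum_const_zero, add_zero] at hmin
  set g : (Fin (N + 1) → Fin n → ℝ) × (Fin N → Fin m → ℝ) → ℝ :=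
    fun z => ∑ t : Fin N, z.2 t ⬝ᵥ (R t *ᵥ z.2 t) with hg
  set S : Set (Fin (N + 1) → Fin n → ℝ) := {w | ∀ t : Fin N, w t.castSucc ∈ 𝓡} with hS
  set T : Set ((Fin (N + 1) → Fin n → ℝ) × (Fin N → Fin m → ℝ)) :=
    {z | z.1 0 = ξ ∧ ∀ t : Fin N, z.1 t.succ = A t *ᵥ z.1 t.castSucc + B t *ᵥ z.2 t} with hT
  have hScv : Convex ℝ S := fun p hp q hq a b ha hb hab t => h𝓡cv (hp t) (hq t) ha hb hab
  have hTcv : Convex ℝ T := by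
    rintro p ⟨hp0, hp⟩ q ⟨hq0, hq⟩ a b ha hb hab
    refine ⟨?_, fun t => ?_⟩
    · simp only [Prod.fst_add, Prod.smul_fst, Pi.add_apply, Pi.smul_apply, hp0, hq0]
      rw [← add_smul, hab, one_smul]
    · simp only [Prod.fst_add, Prod.smul_fst, Prod.snd_add, Prod.smul_snd, Pi.add_apply,
        Pi.smul_apply, hp t, hq t, Matrix.mulVec_add, Matrix.mulVec_smul, smul_add]
      abel
  have hgcv : ConvexOn ℝ T g := by
    refine ⟨hTcv, fun p _ q _ a b ha hb hab => ?_⟩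
    simp only [hg, smul_eq_mul, Finset.mul_sum, ← Finset.sum_add_distrib]
    exact Finset.sum_le_sum fun t _ => (hR t).posSemidef.convexOn_dotProduct_mulVec.2
      (Set.mem_univ (p.2 t)) (Set.mem_univ (q.2 t)) ha hb hab
  set J := trajectoryToEuclidean N n with hJ
  have hsq : ∀ a b c : Fin (N + 1) → Fin n → ℝ,
      ‖J a - J b + J c‖ ^ 2 = ∑ t, ∑ i, (a t i - b t i + c t i) ^ 2 := fun a b c => by
    rw [← map_sub, ← map_add, hJ, norm_sq_trajectoryToEuclidean]
    rfl
  obtain ⟨h1, h2⟩ := admm_tendsto (hCx_cv.subset (Set.subset_univ S) hScv) hgcv J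
    (J ∘ₗ LinearMap.fst ℝ _ _) hρ (r := r) (z := fun k => (x k, u k)) (v := fun k => J (v k))
    (rs := xs) (zs := (xs, us)) (y := J ys)
    hr_feas (fun k => ⟨hx0 k, hxdyn k⟩)
    (fun k w hw => by
      simp only [LinearMap.comp_apply, LinearMap.fst_apply, hsq]
      exact hr_min k w hw)
    (fun k w hw => by
      simp only [LinearMap.comp_apply, LinearMap.fst_apply, hsq]
      exact hxu_min k w.1 w.2 hw.1 hw.2)
    (fun k => by
      simp only [LinearMap.comp_apply, LinearMap.fst_apply, hv, map_sub, map_add])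
    hrs ⟨hxs0, hxsdyn⟩ rfl
    (fun w hw q hq => by
      simp only [LinearMap.comp_apply, LinearMap.fst_apply]
      rw [← map_sub, hJ, inner_trajectoryToEuclidean]
      exact hmin w q.1 q.2 hq.1 hq.2 hw)
  refine ⟨?_, ?_⟩
  · refine tendsto_pi_nhds.2 fun t => tendsto_pi_nhds.2 fun i => ?_
    exact ((EuclideanSpace.proj (𝕜 := ℝ) (t, i)).continuous.tendsto' 0 0 (map_zero _)).comp h1
  · convert h2 using 2
    refine IsLeast.csInf_eq ⟨⟨xs, us, hxs0, hxsdyn, hrs, rfl⟩, ?_⟩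
    rintro _ ⟨x', u', hx', hdyn', hmem, rfl⟩
    simpa using hmin x' x' u' hx' hdyn' hmem
end
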